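/- Fix integers 0 ≤ a ≤ N. Let ONH_a^N := ONH_a / ⟨x_1^N⟩ be the cyclotomic quotient of the odd nilHecke ring by the two-sided ideal generated by (multiplication by) x_1^N, and let OH_{a,N} := OΛ_a / ⟨h_m : m > N−a⟩ be the odd Grassmannian ring, the quotient of OΛ_a by the two-sided ideal generated by the odd complete symmetric polynomials h_m with m > N−a. Then ONH_a^N is isomorphic as a ring to the algebra of a! × a! matrices over OH_{a,N}. -/

import Mathlib

open scoped BigOperators

/-- The defining anticommutation relations of the odd polynomial ring. -/
inductive OddRel (a : ℕ) : FreeAlgebra ℤ (Fin a) → FreeAlgebra ℤ (Fin a) → Prop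
  | anticomm (i j : Fin a) (h : i ≠ j) :
      OddRel a (FreeAlgebra.ι ℤ i * FreeAlgebra.ι ℤ j)
        (-(FreeAlgebra.ι ℤ j * FreeAlgebra.ι ℤ i))

/-- The ring of odd polynomials in `a` variables over `ℤ`. -/
abbrev OPol (a : ℕ) : Type := RingQuot (OddRel a)

/-- The variable `x_{i+1}` (`0`-based index). -/
noncomputable def OX {a : ℕ} (i : Fin a) : OPol a :=
  RingQuot.mkRingHom (OddRel a) (FreeAlgebra.ι ℤ i)

/-- The variable `x_i` (`1`-based index), `0` if out of range. -/
noncomputable def xv (a : ℕ) (i : ℕ) : OPol a :=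
  if h : 1 ≤ i ∧ i ≤ a then OX ⟨i - 1, by omega⟩ else 0

/-- The signed variable `x̃_i = (−1)^{i−1} x_i` (`0`-based index, so the sign is `(−1)^i`). -/
noncomputable def xt (a : ℕ) (i : Fin a) : OPol a := (-1 : OPol a) ^ (i : ℕ) * OX i

/-- Odd elementary symmetric polynomial `ε_k`. -/
noncomputable def eps (a k : ℕ) : OPol a :=
  ∑ t ∈ Finset.powersetCard k (Finset.univ : Finset (Fin a)),
    ((t.sort (· ≤ ·)).map (xt a)).prod

/-- Odd complete symmetric polynomial `h_k`. -/
noncomputable def hp (a k : ℕ) : OPol a :=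
  ∑ σ : Sym (Fin a) k, (((σ : Multiset (Fin a)).sort (· ≤ ·)).map (xt a)).prod

/-- The ordered monomial `x_1^{c_1} ⋯ x_a^{c_a}`. -/
noncomputable def xmon {a : ℕ} (c : Fin a → ℕ) : OPol a :=
  ((List.finRange a).map fun i => OX i ^ c i).prod

/-- The staircase monomial `x^{δ_a} = x_1^{a−1} x_2^{a−2} ⋯ x_a^0`. -/
noncomputable def xdelta (a : ℕ) : OPol a :=
  ((List.finRange a).map fun i => OX i ^ (a - 1 - (i : ℕ))).prod

/-- Composite of the operators `d i` along a word, leftmost letter acting last (outermost). -/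
noncomputable def dword {a : ℕ} (d : ℕ → OPol a →+ OPol a) : List ℕ → (OPol a →+ OPol a)
  | [] => AddMonoidHom.id _
  | i :: l => (d i).comp (dword d l)

/-- The word `1, (2,1), (3,2,1), …, (a−1,…,2,1)` for the longest element, so that
`dword d (DList a) = ∂_1∘(∂_2∘∂_1)∘⋯∘(∂_{a−1}∘⋯∘∂_1) = D_a`. -/
def DList (a : ℕ) : List ℕ :=
  ((List.range a).map fun b => (List.range b).reverse.map (· + 1)).flatten

/-- Left multiplication by `f` as a `ℤ`-linear endomorphism. -/
noncomputable def mulL {a : ℕ} (f : OPol a) : Module.End ℤ (OPol a) :=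
  (AddMonoidHom.mulLeft f).toIntLinearMap

/-- The generators of the odd nilHecke ring inside `End_ℤ(OPol a)`. -/
noncomputable def onhGens (a : ℕ) (d : ℕ → OPol a →+ OPol a) :
    Set (Module.End ℤ (OPol a)) :=
  {T | (∃ i : Fin a, T = mulL (OX i)) ∨
    (∃ i : ℕ, 1 ≤ i ∧ i + 1 ≤ a ∧ T = (d i).toIntLinearMap)}

/-- The simple transposition `s_i` (`1`-based) of `{1,…,a}`. -/
def sperm (a : ℕ) (i : ℕ) : Equiv.Perm (Fin a) :=
  if h : 1 ≤ i ∧ i + 1 ≤ a then Equiv.swap ⟨i - 1, by omega⟩ ⟨i, by omega⟩ else 1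

/-- The permutation associated to a word in the simple transpositions. -/
def wordPerm (a : ℕ) (l : List ℕ) : Equiv.Perm (Fin a) := (l.map (sperm a)).prod

/-- Evaluation of an (even) multivariate polynomial at the squared variables `x_1², …, x_a²`. -/
noncomputable def sqEval {a : ℕ} (p : MvPolynomial (Fin a) ℤ) : OPol a :=
  ∑ m ∈ p.support,
    MvPolynomial.coeff m p • ((List.finRange a).map fun i => OX i ^ (2 * m i)).prod

/-- The odd symmetrization operator `S(f) = (−1)^{C(a,3)} w₀(D_a(f·x^{δ_a}))`. -/
noncomputable def oddSymzn (a : ℕ) (d : ℕ → OPol a →+ OPol a) (W0 : OPol a →+* OPol a)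
    (f : OPol a) : OPol a :=
  (-1 : OPol a) ^ Nat.choose a 3 * W0 (dword d (DList a) (f * xdelta a))

/-- The odd Schur polynomial `s_α = (−1)^{C(a,3)} w₀(D_a(x^α·x^{δ_a}))`. -/
noncomputable def schurP (a : ℕ) (d : ℕ → OPol a →+ OPol a) (W0 : OPol a →+* OPol a)
    (α : Fin a → ℕ) : OPol a :=
  (-1 : OPol a) ^ Nat.choose a 3 * W0 (dword d (DList a) (xmon α * xdelta a))

/-- The 0-Hecke generator `∂̄_r = x_r ∘ ∂_r`. -/
noncomputable def dbar (a : ℕ) (d : ℕ → OPol a →+ OPol a) (r : ℕ) : OPol a →+ OPol a :=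
  (AddMonoidHom.mulLeft (xv a r)).comp (d r)

/-- The `ℤ`-span of products of exactly `n` variables: the degree-`2n` component of `OPol a`. -/
def degComp (a n : ℕ) : Submodule ℤ (OPol a) :=
  Submodule.span ℤ {f : OPol a | ∃ l : List (Fin a), l.length = n ∧ f = (l.map OX).prod}

/-- Odd Schubert polynomial `𝔰_w = ∂_{w⁻¹w₀}(x^{δ_a})` for a fixed choice `red` of
reduced expressions. -/
noncomputable def schubert (a : ℕ) (d : ℕ → OPol a →+ OPol a)
    (red : Equiv.Perm (Fin a) → List ℕ) (w : Equiv.Perm (Fin a)) : OPol a :=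
  dword d (red (w⁻¹ * Fin.revPerm)) (xdelta a)

/-- Product of odd elementary symmetric polynomials along the parts of a partition,
in non-increasing order. -/
noncomputable def epsPart (a : ℕ) {n : ℕ} (p : Nat.Partition n) : OPol a :=
  (((p.parts.sort (· ≤ ·)).reverse).map (eps a)).prod

/-- Odd divided difference operators `δ i` for anticommuting variables `y 0, …, y (a - 1)`, normalised
so that `δ i (y i) = 1` and `δ i (y (i + 1)) = -1`. -/
structure OddDividedDifference (a : ℕ) (A : Type*) [Ring A] where
  y : ℕ → A
  s : ℕ → A →+* A
  δ : ℕ → Module.End ℤ A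
  y_anticomm : ∀ {i j}, i < a → j < a → i ≠ j → y i * y j = -(y j * y i)
  s_left : ∀ {i}, i + 1 < a → s i (y i) = y (i + 1)
  s_right : ∀ {i}, i + 1 < a → s i (y (i + 1)) = y i
  s_of_ne : ∀ {i j}, i + 1 < a → j < a → j ≠ i → j ≠ i + 1 → s i (y j) = -y j
  δ_one : ∀ {i}, i + 1 < a → δ i 1 = 0
  δ_left : ∀ {i}, i + 1 < a → δ i (y i) = 1
  δ_right : ∀ {i}, i + 1 < a → δ i (y (i + 1)) = -1
  δ_of_ne : ∀ {i j}, i + 1 < a → j < a → j ≠ i → j ≠ i + 1 → δ i (y j) = 0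
  δ_mul : ∀ {i}, i + 1 < a → ∀ f g, δ i (f * g) = δ i f * g + s i f * δ i g
  mem_of_closed : ∀ p : AddSubgroup A, 1 ∈ p → (∀ j < a, ∀ f ∈ p, y j * f ∈ p) → ∀ f, f ∈ p

namespace OddDividedDifference

variable {a : ℕ} {A : Type*} [Ring A] (S : OddDividedDifference a A)

section Relations

theorem δ_left_mul {i : ℕ} (hi : i + 1 < a) (f : A) :
    S.δ i (S.y i * f) = f + S.y (i + 1) * S.δ i f := by
  rw [S.δ_mul hi, S.δ_left hi, S.s_left hi, one_mul]

theorem δ_right_mul {i : ℕ} (hi : i + 1 < a) (f : A) :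
    S.δ i (S.y (i + 1) * f) = -f + S.y i * S.δ i f := by
  rw [S.δ_mul hi, S.δ_right hi, S.s_right hi, neg_one_mul]

theorem δ_mul_of_ne {i j : ℕ} (hi : i + 1 < a) (hj : j < a) (h : j ≠ i) (h' : j ≠ i + 1) (f : A) :
    S.δ i (S.y j * f) = -(S.y j * S.δ i f) := by
  rw [S.δ_mul hi, S.δ_of_ne hi hj h h', S.s_of_ne hi hj h h', zero_mul, zero_add, neg_mul]

/-- A linear endomorphism that vanishes at `1` and whose kernel is stable under left multiplication by
the variables is zero. -/
theorem eq_zero_of_stable (T : Module.End ℤ A) (h1 : T 1 = 0)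
    (hy : ∀ j < a, ∀ f, T f = 0 → T (S.y j * f) = 0) (f : A) : T f = 0 :=
  S.mem_of_closed T.toAddMonoidHom.ker h1 hy f

theorem δ_δ {i : ℕ} (hi : i + 1 < a) (f : A) : S.δ i (S.δ i f) = 0 := by
  refine S.eq_zero_of_stable (S.δ i * S.δ i) ?_ ?_ f
  · simp [S.δ_one hi]
  · intro j hj f hf
    simp only [Module.End.mul_apply] at hf ⊢
    rcases eq_or_ne j i with rfl | h
    · simp [S.δ_left_mul hi, S.δ_right_mul hi, hf]
    rcases eq_or_ne j (i + 1) with rfl | h'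
    · simp [S.δ_left_mul hi, S.δ_right_mul hi, hf]
    · simp [S.δ_mul_of_ne hi hj h h', hf]

theorem δ_anticomm {i j : ℕ} (hij : i + 1 < j) (hj : j + 1 < a) (f : A) :
    S.δ j (S.δ i f) = -S.δ i (S.δ j f) := by
  have hi : i + 1 < a := by omega
  rw [eq_neg_iff_add_eq_zero]
  refine S.eq_zero_of_stable (S.δ j * S.δ i + S.δ i * S.δ j) ?_ ?_ f
  · simp [S.δ_one hi, S.δ_one hj]
  · intro k hk f hf
    simp only [LinearMap.add_apply, Module.End.mul_apply, ← eq_neg_iff_add_eq_zero] at hf ⊢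
    rcases eq_or_ne k i with rfl | h
    · simp [S.δ_left_mul hi, S.δ_mul_of_ne hj hi (by omega) (by omega),
        S.δ_mul_of_ne hj hk (by omega) (by omega), hf]
    rcases eq_or_ne k (i + 1) with rfl | h'
    · simp [S.δ_right_mul hi, S.δ_mul_of_ne hj hi (by omega) (by omega),
        S.δ_mul_of_ne hj (by omega : i < a) (by omega) (by omega), hf]
    rcases eq_or_ne k j with rfl | h2
    · simp [S.δ_left_mul hj, S.δ_mul_of_ne hi hj (by omega) (by omega),
        S.δ_mul_of_ne hi hk (by omega) (by omega), hf]
    rcases eq_or_ne k (j + 1) with rfl | h3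
    · simp [S.δ_right_mul hj, S.δ_mul_of_ne hi hj (by omega) (by omega),
        S.δ_mul_of_ne hi (by omega : j < a) (by omega) (by omega), hf]
    · simp [S.δ_mul_of_ne hi hk h h', S.δ_mul_of_ne hj hk h2 h3, hf]

theorem δ_braid {i : ℕ} (hi : i + 2 < a) (f : A) :
    S.δ (i + 1) (S.δ i (S.δ (i + 1) f)) = -S.δ i (S.δ (i + 1) (S.δ i f)) := by
  have h0 : i + 1 < a := by omega
  have h1 : i + 1 + 1 < a := hi
  have hn (f : A) : S.δ (i + 1) (S.y i * f) = -(S.y i * S.δ (i + 1) f) :=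
    S.δ_mul_of_ne h1 (by omega) (by omega) (by omega) f
  have hn' (f : A) : S.δ i (S.y (i + 1 + 1) * f) = -(S.y (i + 1 + 1) * S.δ i f) :=
    S.δ_mul_of_ne h0 (by omega) (by omega) (by omega) f
  rw [eq_neg_iff_add_eq_zero]
  refine S.eq_zero_of_stable
    (S.δ (i + 1) * S.δ i * S.δ (i + 1) + S.δ i * S.δ (i + 1) * S.δ i) ?_ ?_ f
  · simp [S.δ_one h0, S.δ_one h1]
  · intro k hk f hf
    simp only [LinearMap.add_apply, Module.End.mul_apply, ← eq_neg_iff_add_eq_zero] at hf ⊢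
    rcases eq_or_ne k i with rfl | h
    · simp [S.δ_left_mul h0, S.δ_left_mul h1, hn, hn', hf, S.δ_δ h0, S.δ_δ h1]
    rcases eq_or_ne k (i + 1) with rfl | h'
    · simp [S.δ_left_mul h0, S.δ_right_mul h0, S.δ_left_mul h1, S.δ_right_mul h1, hn, hn', hf,
        add_assoc]
    rcases eq_or_ne k (i + 1 + 1) with rfl | h2
    · simp [S.δ_right_mul h0, S.δ_right_mul h1, hn, hn', hf, S.δ_δ h0, S.δ_δ h1]
    · simp [S.δ_mul_of_ne h0 hk h h', S.δ_mul_of_ne h1 hk h' h2, hf]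

end Relations

/-- The subring of elements killed by `δ i` for all `i + 1 < n`. -/
def sym (n : ℕ) (hn : n ≤ a) : Subring A where
  carrier := {f | ∀ i, i + 1 < n → S.δ i f = 0}
  mul_mem' {f g} hf hg i hi := by
    rw [S.δ_mul (by omega), hf i hi, hg i hi, zero_mul, mul_zero, add_zero]
  one_mem' i hi := S.δ_one (by omega)
  add_mem' {f g} hf hg i hi := by rw [map_add, hf i hi, hg i hi, add_zero]
  zero_mem' i _ := map_zero _
  neg_mem' {f} hf i hi := by rw [map_neg, hf i hi, neg_zero]

theorem sym_succ_le {n : ℕ} (hn : n + 1 ≤ a) : S.sym (n + 1) hn ≤ S.sym n (by omega) :=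
  fun _ hf i hi => hf i (by omega)

theorem y_mem_sym {n : ℕ} (hn : n < a) : S.y n ∈ S.sym n hn.le :=
  fun i hi => S.δ_of_ne (by omega) hn (by omega) (by omega)

theorem δ_mul_sym {n i : ℕ} (hn : n ≤ a) (hi : i + 1 < n) (f : A) {c : A} (hc : c ∈ S.sym n hn) :
    S.δ i (f * c) = S.δ i f * c := by
  rw [S.δ_mul (by omega), hc i hi, mul_zero, add_zero]

section Expansion

open Finset

/-- The coefficient operators in the expansion of an element of `sym n` in powers of `y n` over
`sym (n + 1)`. -/
def coeffOp : ℕ → ℕ → Module.End ℤ A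
  | 0, 0 => 1
  | 0, _ + 1 => 0
  | n + 1, 0 => coeffOp n 0 * S.δ n * LinearMap.mulLeft ℤ (S.y n)
  | n + 1, j + 1 => -(coeffOp n j * S.δ n) +
      (-1 : ℤ) ^ (j + 1) • (coeffOp n (j + 1) * S.δ n * LinearMap.mulLeft ℤ (S.y n))

theorem coeffOp_eq_zero {n j : ℕ} (h : n < j) : S.coeffOp n j = 0 := by
  induction n generalizing j with
  | zero => obtain ⟨j, rfl⟩ := Nat.exists_eq_succ_of_ne_zero h.ne'; rfl
  | succ n ih =>
    obtain ⟨j, rfl⟩ : ∃ k, j = k + 1 := ⟨j - 1, by omega⟩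
    simp [coeffOp, ih (show n < j by omega), ih (show n < j + 1 by omega)]

theorem coeffOp_y_mul {n m : ℕ} (hnm : n < m) (hm : m < a) (j : ℕ) (f : A) :
    S.coeffOp n j (S.y m * f) = (-1 : ℤ) ^ j • (S.y m * S.coeffOp n j f) := by
  induction n generalizing j f with
  | zero => cases j <;> simp [coeffOp]
  | succ n ih =>
    have hδ (f : A) : S.δ n (S.y m * f) = -(S.y m * S.δ n f) :=
      S.δ_mul_of_ne (by omega) hm (by omega) (by omega) f
    have hy : S.y n * (S.y m * f) = -(S.y m * (S.y n * f)) := by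
      rw [← mul_assoc, S.y_anticomm (by omega) hm (by omega), neg_mul, mul_assoc]
    have ih' := fun j f => ih (by omega) j f
    cases j with
    | zero => simp [coeffOp, hy, hδ, ih']
    | succ j =>
      simp only [coeffOp, LinearMap.add_apply, LinearMap.neg_apply, LinearMap.smul_apply,
        Module.End.mul_apply, LinearMap.mulLeft_apply, hy, hδ, ih', map_neg, smul_neg, neg_neg,
        mul_add, mul_neg, smul_add, mul_smul_comm, pow_succ, neg_smul, mul_one]

theorem coeffOp_mul_sym {n : ℕ} (hn : n < a) (j : ℕ) (f : A) {c : A} (hc : c ∈ S.sym (n + 1) hn) :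
    S.coeffOp n j (f * c) = S.coeffOp n j f * c := by
  induction n generalizing j f with
  | zero => cases j <;> simp [coeffOp]
  | succ n ih =>
    have ih' := fun j f => ih (by omega) j f (S.sym_succ_le hn hc)
    have hδ (f : A) : S.δ n (f * c) = S.δ n f * c := S.δ_mul_sym hn (by omega) f hc
    cases j with
    | zero => simp [coeffOp, ← mul_assoc, hδ, ih']
    | succ j =>
      simp only [coeffOp, LinearMap.add_apply, LinearMap.neg_apply, LinearMap.smul_apply,
        Module.End.mul_apply, LinearMap.mulLeft_apply, ← mul_assoc, hδ, ih', add_mul, neg_mul,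
        smul_mul_assoc]

theorem coeffOp_one {n : ℕ} (hn : n < a) (j : ℕ) :
    S.coeffOp n j 1 = if j = 0 then 1 else 0 := by
  induction n generalizing j with
  | zero => cases j <;> simp [coeffOp]
  | succ n ih => cases j <;> simp [coeffOp, S.δ_one hn, S.δ_left hn, ih (by omega)]

theorem coeffOp_sym {n : ℕ} (hn : n < a) (j : ℕ) {c : A} (hc : c ∈ S.sym (n + 1) hn) :
    S.coeffOp n j c = if j = 0 then c else 0 := by
  rw [← one_mul c, S.coeffOp_mul_sym hn j 1 hc, S.coeffOp_one hn]
  split_ifs <;> simp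

theorem coeffOp_succ_zero {n : ℕ} (hn : n + 1 < a) {f : A} (hf : f ∈ S.sym (n + 1) hn.le) :
    S.coeffOp (n + 1) 0 f = f + S.y (n + 1) * S.coeffOp n 0 (S.δ n f) := by
  simp [coeffOp, S.δ_left_mul hn, S.coeffOp_sym (by omega) 0 hf, S.coeffOp_y_mul (Nat.lt_succ_self n) hn]

theorem coeffOp_succ_succ {n : ℕ} (hn : n + 1 < a) (j : ℕ) {f : A} (hf : f ∈ S.sym (n + 1) hn.le) :
    S.coeffOp (n + 1) (j + 1) f =
      S.y (n + 1) * S.coeffOp n (j + 1) (S.δ n f) - S.coeffOp n j (S.δ n f) := by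
  simp only [coeffOp, LinearMap.add_apply, LinearMap.neg_apply, LinearMap.smul_apply,
    Module.End.mul_apply, LinearMap.mulLeft_apply, S.δ_left_mul hn, map_add,
    S.coeffOp_sym (Nat.lt_of_succ_lt hn) (j + 1) hf, S.coeffOp_y_mul (Nat.lt_succ_self n) hn,
    if_neg (Nat.succ_ne_zero j), zero_add, smul_smul, ← pow_add, Even.neg_one_pow ⟨j + 1, rfl⟩,
    one_smul]
  abel

theorem sum_coeffOp {n : ℕ} (hn : n < a) {f : A} (hf : f ∈ S.sym n hn.le) :
    ∑ j ∈ range (n + 1), S.y n ^ j * S.coeffOp n j f = f := by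
  cases n with
  | zero => simp [coeffOp]
  | succ n =>
    set u : ℕ → A := fun j => S.y (n + 1) ^ (j + 1) * S.coeffOp n j (S.δ n f) with hu
    have key (j : ℕ) : S.y (n + 1) ^ (j + 1) * S.coeffOp (n + 1) (j + 1) f = u (j + 1) - u j := by
      rw [S.coeffOp_succ_succ hn j hf, hu, mul_sub, ← mul_assoc, ← pow_succ]
    rw [sum_range_succ', sum_congr rfl fun j _ => key j, sum_range_sub, S.coeffOp_succ_zero hn hf]
    simp [hu, S.coeffOp_eq_zero (Nat.lt_succ_self n)]

theorem δ_y_pow {n : ℕ} (hn : n + 1 < a) (k : ℕ) :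
    S.δ n (S.y (n + 1) ^ k) = -∑ p ∈ range k, S.y n ^ p * S.y (n + 1) ^ (k - 1 - p) := by
  induction k with
  | zero => simp [S.δ_one hn]
  | succ k ih =>
    rw [pow_succ', S.δ_right_mul hn, ih, sum_range_succ', mul_neg, mul_sum, neg_add_rev]
    simp only [pow_succ', mul_assoc, add_tsub_cancel_right, pow_zero, one_mul, tsub_zero]
    congr 2
    refine sum_congr rfl fun p _ => ?_
    rw [show k - 1 - p = k - (p + 1) by omega]

theorem coeffOp_y_pow {n : ℕ} (hn : n < a) (j : ℕ) {k : ℕ} (hk : k ≤ n) :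
    S.coeffOp n j (S.y n ^ k) = if j = k then 1 else 0 := by
  induction n generalizing j k with
  | zero =>
    obtain rfl : k = 0 := by omega
    cases j <;> simp [coeffOp]
  | succ n ih =>
    have hy : S.y (n + 1) ∈ S.sym (n + 1) hn.le := S.y_mem_sym hn
    have key (j : ℕ) : S.coeffOp n j (S.δ n (S.y (n + 1) ^ k)) =
        if j < k then -S.y (n + 1) ^ (k - 1 - j) else 0 := by
      rw [S.δ_y_pow hn, map_neg, map_sum]
      have : ∀ p ∈ range k, S.coeffOp n j (S.y n ^ p * S.y (n + 1) ^ (k - 1 - p)) =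
          if j = p then S.y (n + 1) ^ (k - 1 - p) else 0 := fun p hp => by
        rw [mem_range] at hp
        rw [S.coeffOp_mul_sym (by omega) j _ (Subring.pow_mem _ hy _), ih (by omega) j (by omega)]
        split_ifs <;> simp
      rw [sum_congr rfl this, sum_ite_eq]
      simp only [mem_range]
      split_ifs <;> simp
    cases j with
    | zero =>
      rw [S.coeffOp_succ_zero hn (Subring.pow_mem _ hy _), key]
      cases k with
      | zero => simp
      | succ k => simp [← pow_succ']
    | succ j =>
      rw [S.coeffOp_succ_succ hn j (Subring.pow_mem _ hy _), key, key]
      rcases lt_trichotomy (j + 1) k with h | h | h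
      · rw [if_pos h, if_pos (by omega), if_neg h.ne, show k - 1 - j = k - 1 - (j + 1) + 1 by omega,
          pow_succ']
        simp
      · subst h
        simp
      · rw [if_neg (by omega), if_neg (by omega), if_neg h.ne']
        simp

end Expansion

section Image

/-- Signed odd elementary symmetric polynomials of degree `n - j` in `y 0, …, y (n - 1)`. -/
def elem : ℕ → ℕ → A
  | 0, 0 => 1
  | 0, _ + 1 => 0
  | n + 1, 0 => (-1) ^ n * (elem n 0 * S.y n)
  | n + 1, j + 1 => (-1) ^ n * ((-1) ^ (j + 1) * elem n j + elem n (j + 1) * S.y n)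

/-- The composite `δ 0 ∘ δ 1 ∘ ⋯ ∘ δ (n - 1)`. -/
def δProd : ℕ → Module.End ℤ A
  | 0 => 1
  | n + 1 => δProd n * S.δ n

theorem map_neg_one_pow_mul (T : Module.End ℤ A) (k : ℕ) (f : A) :
    T ((-1) ^ k * f) = (-1) ^ k * T f := by
  rcases neg_one_pow_eq_or A k with h | h <;> simp [h]

theorem δ_elem_mul {n i : ℕ} (hni : n ≤ i) (hi : i + 1 < a) (j : ℕ) (f : A) :
    S.δ i (S.elem n j * f) = (-1) ^ (n + j) * (S.elem n j * S.δ i f) := by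
  induction n generalizing j f with
  | zero => cases j <;> simp [elem]
  | succ n ih =>
    have ih' := fun j f => ih (by omega) j f
    have hy (f : A) : S.δ i (S.y n * f) = -(S.y n * S.δ i f) :=
      S.δ_mul_of_ne hi (by omega) (by omega) (by omega) f
    cases j with
    | zero =>
      simp only [elem, mul_assoc, map_neg_one_pow_mul, ih', hy, pow_succ, pow_add]
      simp
    | succ j =>
      simp only [elem, mul_assoc, map_neg_one_pow_mul, ih', hy, add_mul, map_add]
      rcases Nat.even_or_odd n with h | h <;> rcases Nat.even_or_odd j with h' | h' <;>
        simp [h.neg_one_pow, h'.neg_one_pow, pow_succ, pow_add, add_comm]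

theorem coeffOp_eq_δProd {n : ℕ} (hn : n < a) (j : ℕ) (f : A) :
    S.coeffOp n j f = S.δProd n (S.elem n j * f) := by
  induction n generalizing j f with
  | zero => cases j <;> simp [coeffOp, elem, δProd]
  | succ n ih =>
    have ih' := fun j f => ih (by omega) j f
    cases j with
    | zero =>
      simp only [coeffOp, δProd, elem, Module.End.mul_apply, LinearMap.mulLeft_apply, mul_assoc,
        map_neg_one_pow_mul, S.δ_elem_mul le_rfl hn, ih', add_zero]
      simp [← mul_assoc, ← sq, ← pow_mul]
    | succ j =>
      simp only [coeffOp, δProd, elem, LinearMap.add_apply, LinearMap.neg_apply,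
        Module.End.mul_apply, LinearMap.mulLeft_apply, mul_assoc, add_mul,
        map_add, map_neg_one_pow_mul, S.δ_elem_mul le_rfl hn, ih', zsmul_eq_mul]
      rcases Nat.even_or_odd n with h | h <;> rcases Nat.even_or_odd j with h' | h' <;>
        simp [h.neg_one_pow, h'.neg_one_pow, pow_succ, pow_add, add_comm]

theorem elem_mem_sym {n : ℕ} (hn : n ≤ a) (j : ℕ) : S.elem n j ∈ S.sym n hn := by
  have hy (m : ℕ) (hm : m + 1 < a) : S.δ m (S.y m * S.y (m + 1)) = 0 := by
    rw [S.δ_left_mul hm, S.δ_right hm, mul_neg_one, add_neg_cancel]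
  induction n generalizing j with
  | zero => exact fun i hi => by omega
  | succ n ih =>
    intro i hi
    rcases eq_or_ne (i + 1) n with rfl | h
    · have hi' : i + 1 < a := by omega
      have he (j : ℕ) : S.δ i (S.elem i j) = 0 := by
        simpa [S.δ_one hi'] using S.δ_elem_mul le_rfl hi' j 1
      rcases j with _ | _ | j
      · simp only [elem, mul_assoc, map_neg_one_pow_mul, S.δ_elem_mul le_rfl hi', hy i hi', mul_zero]
      · simp only [elem, mul_assoc, map_neg_one_pow_mul, S.δ_elem_mul le_rfl hi', hy i hi', mul_zero,
          add_mul, map_add, mul_add, S.δ_left hi', S.δ_right hi']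
        simp [← mul_assoc]
      · simp only [elem, mul_assoc, map_neg_one_pow_mul, S.δ_elem_mul le_rfl hi', hy i hi', mul_zero,
          add_mul, map_add, mul_add, S.δ_left hi', S.δ_right hi', he]
        rcases Nat.even_or_odd i with h | h <;> rcases Nat.even_or_odd j with h' | h' <;>
          simp [h.neg_one_pow, h'.neg_one_pow, pow_succ, pow_add]
    · have hin : i + 1 < n := by omega
      have hys : S.y n ∈ S.sym n (by omega) := S.y_mem_sym hn
      cases j with
      | zero =>
        rw [elem, map_neg_one_pow_mul, S.δ_mul_sym (by omega) hin _ hys, ih (by omega) 0 i hin]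
        simp
      | succ j =>
        rw [elem, map_neg_one_pow_mul, map_add, map_neg_one_pow_mul,
          S.δ_mul_sym (by omega) hin _ hys, ih (by omega) _ i hin, ih (by omega) _ i hin]
        simp

theorem δ_mem_sym {n : ℕ} (hn : n + 1 < a) {f : A} (hf : f ∈ S.sym (n + 1) hn.le) :
    S.δ n f ∈ S.sym n (by omega) := fun i hi => by
  have h := S.δ_anticomm hi hn f
  rw [hf i (by omega), map_zero] at h
  exact (neg_eq_zero.mp h.symm)

theorem δ_δProd_comm {n i : ℕ} (hni : n < i) (hi : i + 1 < a) (f : A) :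
    S.δ i (S.δProd n f) = (-1) ^ n * S.δProd n (S.δ i f) := by
  induction n generalizing f with
  | zero => simp [δProd]
  | succ n ih =>
    simp only [δProd, Module.End.mul_apply]
    rw [ih (by omega), S.δ_anticomm hni hi, map_neg, pow_succ, mul_neg_one, mul_neg, neg_mul]

theorem δProd_mem_sym {n : ℕ} (hn : n < a) {f : A} (hf : f ∈ S.sym n hn.le) :
    S.δProd n f ∈ S.sym (n + 1) hn := by
  induction n generalizing f with
  | zero => exact fun i hi => by omega
  | succ n ih =>
    intro i hi
    rcases eq_or_ne i n with rfl | h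
    · cases i with
      | zero => exact S.δ_δ hn f
      | succ m =>
        simp only [δProd, Module.End.mul_apply]
        rw [S.δ_δProd_comm (Nat.lt_succ_self m) hn, S.δ_braid hn, hf m (by omega)]
        simp
    · exact ih (by omega) (S.δ_mem_sym hn hf) i (by omega)

theorem coeffOp_mem_sym {n : ℕ} (hn : n < a) (j : ℕ) {f : A} (hf : f ∈ S.sym n hn.le) :
    S.coeffOp n j f ∈ S.sym (n + 1) hn := by
  rw [S.coeffOp_eq_δProd hn]
  exact S.δProd_mem_sym hn (mul_mem (S.elem_mem_sym hn.le j) hf)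

end Image

section Complete

/-- Odd complete symmetric polynomials in `y 0, …, y (n - 1)`, with variables in decreasing order. -/
def complete : ℕ → ℕ → A
  | _, 0 => 1
  | 0, _ + 1 => 0
  | n + 1, k + 1 => complete n (k + 1) + S.y n * complete (n + 1) k

@[simp] theorem complete_zero_right (n : ℕ) : S.complete n 0 = 1 := by
  rw [complete]

theorem complete_succ_succ (n k : ℕ) :
    S.complete (n + 1) (k + 1) = S.complete n (k + 1) + S.y n * S.complete (n + 1) k := by
  rw [complete]

theorem complete_one (k : ℕ) : S.complete 1 k = S.y 0 ^ k := by
  induction k with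
  | zero => simp
  | succ k ih => rw [complete, complete, ih, zero_add, pow_succ']

theorem δ_complete_of_le {n i : ℕ} (hni : n ≤ i) (hi : i + 1 < a) (k : ℕ) :
    S.δ i (S.complete n k) = 0 := by
  induction n generalizing k with
  | zero => cases k <;> simp [complete, S.δ_one hi]
  | succ n ihn =>
    induction k with
    | zero => simp [S.δ_one hi]
    | succ k ihk =>
      rw [complete, map_add, S.δ_mul_of_ne hi (by omega) (by omega) (by omega), ihk,
        ihn (by omega), mul_zero, neg_zero, add_zero]

theorem δ_complete {n : ℕ} (hn : n + 1 < a) (k : ℕ) :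
    S.δ n (S.complete (n + 1) (k + 1)) = S.complete (n + 2) k := by
  induction k with
  | zero => simp [complete, S.δ_left hn, S.δ_complete_of_le le_rfl hn]
  | succ k ih =>
    rw [complete, map_add, S.δ_complete_of_le le_rfl hn, S.δ_left_mul hn, ih, zero_add,
      S.complete_succ_succ (n + 1)]

theorem complete_mem_sym {n : ℕ} (hn : n ≤ a) (k : ℕ) : S.complete n k ∈ S.sym n hn := by
  induction n generalizing k with
  | zero => exact fun i hi => by omega
  | succ n ihn =>
    intro i hi
    rcases eq_or_ne (i + 1) n with rfl | h
    · rw [← S.δ_complete (by omega), S.δ_δ (by omega)]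
    · induction k with
      | zero => simp [S.δ_one (by omega : i + 1 < a)]
      | succ k ihk =>
        rw [complete, map_add, S.δ_mul_of_ne (by omega) (by omega) (by omega) (by omega), ihk,
          ihn (by omega) _ i (by omega), mul_zero, neg_zero, add_zero]

theorem complete_mem_of_complete_mem {N : ℕ} (haN : a ≤ N) (I : Submodule A A)
    (hI : ∀ m, N - a < m → S.complete a m ∈ I) {n k : ℕ} (hn : n ≤ a) (hk : N < k + n) :
    S.complete n k ∈ I := by
  induction hn using Nat.decreasingInduction generalizing k with
  | self => exact hI k (by omega)
  | of_succ n hn ih =>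
    obtain ⟨k, rfl⟩ : ∃ l, k = l + 1 := ⟨k - 1, by omega⟩
    have h := S.complete_succ_succ n k
    rw [eq_sub_of_add_eq h.symm]
    exact I.sub_mem (ih (by omega)) (I.smul_mem _ (ih (by omega)))

theorem y_zero_pow_mem {N : ℕ} (ha : 1 ≤ a) (haN : a ≤ N) (I : Submodule A A)
    (hI : ∀ m, N - a < m → S.complete a m ∈ I) : S.y 0 ^ N ∈ I :=
  S.complete_one N ▸ S.complete_mem_of_complete_mem haN I hI ha (Nat.lt_succ_self N)

/-- The composite `δ (n - 1) ∘ ⋯ ∘ δ 1 ∘ δ 0`. -/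
def δProdRev : ℕ → Module.End ℤ A
  | 0 => 1
  | n + 1 => S.δ n * δProdRev n

theorem δProdRev_y_zero_pow {n : ℕ} (hn : n < a) (k : ℕ) :
    S.δProdRev n (S.y 0 ^ (k + n)) = S.complete (n + 1) k := by
  induction n generalizing k with
  | zero => simp [δProdRev, complete_one]
  | succ n ih =>
    rw [δProdRev, Module.End.mul_apply, ← S.δ_complete hn, ← ih (by omega), add_right_comm, add_assoc]

end Complete

end OddDividedDifference

section RingQuot

theorem RingQuot.mem_of_mkRingHom_eq_zero {R : Type*} [Ring R] {r : R → R → Prop}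
    (I : TwoSidedIdeal R) (hI : ∀ u v, r u v → u - v ∈ I) {c : R}
    (hc : RingQuot.mkRingHom r c = 0) : c ∈ I := by
  have h := RingQuot.lift_mkRingHom_apply I.ringCon.mk'
    (r := r) (fun u v huv => (RingCon.eq _).mpr ((I.rel_iff u v).mpr (hI u v huv))) c
  rw [hc, map_zero] at h
  exact (RingCon.eq _).mp h.symm

/-- Ring quotients by relations that correspond under a ring isomorphism are isomorphic. -/
noncomputable def RingQuot.congr {R R' : Type*} [Ring R] [Ring R'] {r : R → R → Prop}
    {r' : R' → R' → Prop} (e : R ≃+* R') (h : ∀ u v, r u v ↔ r' (e u) (e v)) :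
    RingQuot r ≃+* RingQuot r' :=
  RingEquiv.ofRingHom
    (RingQuot.lift ⟨(RingQuot.mkRingHom r').comp e.toRingHom,
      fun u v huv => RingQuot.mkRingHom_rel ((h u v).mp huv)⟩)
    (RingQuot.lift ⟨(RingQuot.mkRingHom r).comp e.symm.toRingHom,
      fun u v huv => RingQuot.mkRingHom_rel ((h _ _).mpr (by simpa using huv))⟩)
    (by ext; simp [RingQuot.lift_mkRingHom_apply])
    (by ext; simp [RingQuot.lift_mkRingHom_apply])

end RingQuot

/-- A finite family `b` in a ring `A` together with coordinate operators `l`, taken from a ring `R` of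
endomorphisms of `A`, exhibiting `A` as a free right module over the subring `P`. -/
structure DualFamily {A : Type*} [Ring A] (R : Subring (Module.End ℤ A)) (P : Subring A)
    (ι : Type*) [Fintype ι] [DecidableEq ι] where
  b : ι → A
  l : ι → Module.End ℤ A
  l_mem : ∀ i, l i ∈ R
  l_apply_mem : ∀ i f, l i f ∈ P
  l_mul : ∀ i f, ∀ c ∈ P, l i (f * c) = l i f * c
  l_b : ∀ i j, l i (b j) = if i = j then 1 else 0
  sum_b_mul_l : ∀ f, ∑ i, b i * l i f = f

namespace DualFamily

variable {A : Type*} [Ring A] {R : Subring (Module.End ℤ A)} {P : Subring A}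
  {ι : Type*} [Fintype ι] [DecidableEq ι] (D : DualFamily R P ι)

/-- Transport a dual family along a bijection of index types. -/
def reindex {κ : Type*} [Fintype κ] [DecidableEq κ] (e : κ ≃ ι) : DualFamily R P κ where
  b := D.b ∘ e
  l := D.l ∘ e
  l_mem i := D.l_mem _
  l_apply_mem i f := D.l_apply_mem _ f
  l_mul i f c hc := D.l_mul _ f c hc
  l_b i j := by simp [D.l_b]
  sum_b_mul_l f := (e.sum_comp fun i => D.b i * D.l i f).trans (D.sum_b_mul_l f)

variable (hlin : ∀ T ∈ R, ∀ f, ∀ c ∈ P, T (f * c) = T f * c)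

/-- The matrix of an operator with respect to a dual family. -/
def toMatrix : R →+* Matrix ι ι P where
  toFun T := Matrix.of fun i j => ⟨D.l i (T.1 (D.b j)), D.l_apply_mem _ _⟩
  map_one' := by
    ext i j
    by_cases h : i = j <;> simp [D.l_b, Matrix.one_apply, h]
  map_mul' T T' := by
    ext i j
    simp only [Matrix.mul_apply, Matrix.of_apply, Subring.coe_mul, Module.End.mul_apply,
      AddSubmonoidClass.coe_finsetSum]
    conv_lhs => rw [← D.sum_b_mul_l (T'.1 (D.b j))]
    simp only [map_sum]
    exact Finset.sum_congr rfl fun k _ => by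
      rw [hlin T T.2 _ _ (D.l_apply_mem _ _), D.l_mul _ _ _ (D.l_apply_mem _ _)]
  map_zero' := by ext; simp
  map_add' T T' := by ext; simp

theorem coe_toMatrix_apply (T : R) (i j : ι) :
    (D.toMatrix hlin T i j : A) = D.l i (T.1 (D.b j)) := rfl

variable (hmul : ∀ f, LinearMap.mulLeft ℤ f ∈ R)

/-- The operator whose matrix has `c` as its `(i, j)` entry and is zero elsewhere. -/
def ofEntry (i j : ι) : P →+ R where
  toFun c := ⟨LinearMap.mulLeft ℤ (D.b i * c) * D.l j, mul_mem (hmul _) (D.l_mem j)⟩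
  map_zero' := by ext; simp
  map_add' c c' := by ext; simp [mul_add, add_mul, mul_assoc]

theorem coe_ofEntry_apply (i j : ι) (c : P) (f : A) :
    (D.ofEntry hmul i j c : Module.End ℤ A) f = D.b i * c * D.l j f := rfl

theorem ofEntry_mul (i j k : ι) (c c' : P) :
    D.ofEntry hmul i j c * D.ofEntry hmul j k c' = D.ofEntry hmul i k (c * c') := by
  ext f
  simp only [Subring.coe_mul, Module.End.mul_apply, coe_ofEntry_apply, mul_assoc]
  rw [D.l_mul _ _ _ (mul_mem c'.2 (D.l_apply_mem _ _)), D.l_b, if_pos rfl, one_mul]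

theorem toMatrix_ofEntry (i j : ι) (c : P) :
    D.toMatrix hlin (D.ofEntry hmul i j c) = Matrix.single i j c := by
  ext p q
  rw [coe_toMatrix_apply, coe_ofEntry_apply, mul_assoc,
    D.l_mul _ _ _ (mul_mem c.2 (D.l_apply_mem _ _)), D.l_b, D.l_b, Matrix.single_apply]
  by_cases h : p = i <;> by_cases h' : j = q <;> simp [h, h', Ne.symm]

theorem sum_ofEntry_toMatrix (T : R) :
    ∑ i, ∑ j, D.ofEntry hmul i j (D.toMatrix hlin T i j) = T := by
  ext f
  have h (j : ι) : ∑ i, D.b i * (D.l i (T.1 (D.b j)) * D.l j f) = T.1 (D.b j * D.l j f) := by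
    simp only [← mul_assoc, ← Finset.sum_mul, D.sum_b_mul_l]
    rw [hlin T T.2 _ _ (D.l_apply_mem _ _)]
  simp only [AddSubmonoidClass.coe_finsetSum, LinearMap.sum_apply, coe_ofEntry_apply,
    coe_toMatrix_apply, mul_assoc]
  rw [Finset.sum_comm, Finset.sum_congr rfl fun j _ => h j, ← map_sum, D.sum_b_mul_l]

include D hlin hmul in
/-- A quotient of `R` is a matrix ring over the corresponding quotient of `P`. -/
theorem nonempty_ringQuot_equiv_matrix (r : R → R → Prop) (r' : P → P → Prop)
    (hr : ∀ u v, r u v → ∀ i j, RingQuot.mkRingHom r' (D.toMatrix hlin u i j) =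
      RingQuot.mkRingHom r' (D.toMatrix hlin v i j))
    (hr' : ∀ u v, r' u v → ∀ i j, RingQuot.mkRingHom r (D.ofEntry hmul i j u) =
      RingQuot.mkRingHom r (D.ofEntry hmul i j v)) :
    Nonempty (RingQuot r ≃+* Matrix ι ι (RingQuot r')) := by
  set φ : R →+* Matrix ι ι (RingQuot r') :=
    (RingQuot.mkRingHom r').mapMatrix.comp (D.toMatrix hlin) with hφ
  have hrel : ∀ u v, r u v → φ u = φ v := fun u v huv => by
    ext i j
    exact hr u v huv i j
  let K : TwoSidedIdeal P := TwoSidedIdeal.mk'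
    {c | ∀ i j, RingQuot.mkRingHom r (D.ofEntry hmul i j c) = 0}
    (fun i j => by simp)
    (fun hx hy i j => by simp [hx i j, hy i j])
    (fun hx i j => by simp [hx i j])
    (fun hy i j => by rw [← D.ofEntry_mul hmul i j j, map_mul, hy, mul_zero])
    (fun hx i j => by rw [← D.ofEntry_mul hmul i j j, map_mul, hx, zero_mul])
  have hK : ∀ u v, r' u v → u - v ∈ K := fun u v huv => by
    rw [TwoSidedIdeal.mem_mk']
    intro i j
    rw [map_sub, map_sub, hr' u v huv, sub_self]
  refine ⟨RingEquiv.ofBijective (RingQuot.lift ⟨φ, hrel⟩) ⟨?_, ?_⟩⟩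
  · rw [injective_iff_map_eq_zero]
    intro t ht
    obtain ⟨T, rfl⟩ := RingQuot.mkRingHom_surjective r t
    rw [RingQuot.lift_mkRingHom_apply] at ht
    have h0 (i j : ι) : RingQuot.mkRingHom r (D.ofEntry hmul i j (D.toMatrix hlin T i j)) = 0 :=
      (TwoSidedIdeal.mem_mk' _ _ _ _ _ _ _).mp
        (RingQuot.mem_of_mkRingHom_eq_zero K hK (congrFun (congrFun ht i) j)) i j
    rw [← D.sum_ofEntry_toMatrix hlin hmul T]
    simp [map_sum, h0]
  · intro M
    choose C hC using fun i j => RingQuot.mkRingHom_surjective r' (M i j)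
    refine ⟨RingQuot.mkRingHom r (∑ i, ∑ j, D.ofEntry hmul i j (C i j)), ?_⟩
    rw [RingQuot.lift_mkRingHom_apply, hφ]
    ext p q
    simp only [RingHom.comp_apply, map_sum, D.toMatrix_ofEntry, RingHom.mapMatrix_apply,
      Matrix.map_single, hC, ← Matrix.matrix_eq_sum_single]

end DualFamily

namespace OddDividedDifference

variable {a : ℕ} {A : Type*} [Ring A] (S : OddDividedDifference a A)

section Frame

variable {R : Subring (Module.End ℤ A)} (hmul : ∀ f, LinearMap.mulLeft ℤ f ∈ R)
  (hδ : ∀ i, i + 1 < a → S.δ i ∈ R)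

include hmul hδ in
theorem coeffOp_mem {n : ℕ} (hn : n < a) (j : ℕ) : S.coeffOp n j ∈ R := by
  induction n generalizing j with
  | zero => cases j; exacts [one_mem _, zero_mem _]
  | succ n ih =>
    have ih' := fun j => ih (by omega) j
    cases j with
    | zero => exact mul_mem (mul_mem (ih' 0) (hδ n hn)) (hmul _)
    | succ j =>
      exact add_mem (neg_mem (mul_mem (ih' j) (hδ n hn)))
        (zsmul_mem (mul_mem (mul_mem (ih' (j + 1)) (hδ n hn)) (hmul _)) _)

/-- Refine a dual family over `sym n` to one over `sym (n + 1)` by expanding in powers of `y n`. -/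
def succDualFamily {n : ℕ} (hn : n < a) {ι : Type*} [Fintype ι] [DecidableEq ι]
    (D : DualFamily R (S.sym n hn.le) ι) : DualFamily R (S.sym (n + 1) hn) (Fin (n + 1) × ι) where
  b p := D.b p.2 * S.y n ^ (p.1 : ℕ)
  l p := S.coeffOp n p.1 * D.l p.2
  l_mem p := mul_mem (S.coeffOp_mem hmul hδ hn _) (D.l_mem _)
  l_apply_mem p f := S.coeffOp_mem_sym hn _ (D.l_apply_mem _ f)
  l_mul p f c hc := by
    rw [Module.End.mul_apply, D.l_mul _ _ _ (S.sym_succ_le hn hc), S.coeffOp_mul_sym hn _ _ hc,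
      Module.End.mul_apply]
  l_b p q := by
    rw [Module.End.mul_apply, D.l_mul _ _ _ (pow_mem (S.y_mem_sym hn) _), D.l_b]
    by_cases h : p.2 = q.2
    · rw [if_pos h, one_mul, S.coeffOp_y_pow hn _ (Nat.le_of_lt_succ q.1.2)]
      simp [Prod.ext_iff, h, Fin.ext_iff]
    · simp [Prod.ext_iff, h]
  sum_b_mul_l f := by
    rw [Fintype.sum_prod_type_right]
    conv_rhs => rw [← D.sum_b_mul_l f]
    refine Finset.sum_congr rfl fun i _ => ?_
    conv_rhs => rw [← S.sum_coeffOp hn (D.l_apply_mem i f), Finset.sum_range, Finset.mul_sum]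
    simp [mul_assoc]

include hmul hδ in
theorem exists_dualFamily {n : ℕ} (hn : n ≤ a) :
    ∃ D : DualFamily R (S.sym n hn) (Fin n.factorial), ∀ i,
      S.y 0 * D.b i = D.b i * S.y 0 ∨ S.y 0 * D.b i = -(D.b i * S.y 0) := by
  induction n with
  | zero =>
    refine ⟨⟨fun _ => 1, fun _ => 1, fun _ => one_mem R, fun _ _ _ hj => absurd hj (by omega),
      by simp, fun i j => (if_pos (@Subsingleton.elim (Fin 1) _ i j)).symm, fun f => ?_⟩, by simp⟩
    exact (Fin.sum_univ_one _).trans (one_mul f)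
  | succ n ih =>
    obtain ⟨D, hD⟩ := ih (by omega)
    refine ⟨(S.succDualFamily hmul hδ hn D).reindex finProdFinEquiv.symm, fun i => ?_⟩
    change S.y 0 * (D.b _ * S.y n ^ _) = D.b _ * S.y n ^ _ * S.y 0 ∨
      S.y 0 * (D.b _ * S.y n ^ _) = -(D.b _ * S.y n ^ _ * S.y 0)
    generalize finProdFinEquiv.symm i = p
    obtain ⟨j, k⟩ := p
    have hy : S.y 0 * S.y n ^ (j : ℕ) = S.y n ^ (j : ℕ) * S.y 0 ∨
        S.y 0 * S.y n ^ (j : ℕ) = -(S.y n ^ (j : ℕ) * S.y 0) := by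
      rcases Nat.eq_zero_or_pos n with rfl | h
      · exact .inl (Commute.pow_right rfl _).eq
      · generalize (j : ℕ) = j
        induction j with
        | zero => simp
        | succ j ihj =>
          have hyn := S.y_anticomm (show 0 < a by omega) hn h.ne
          rcases ihj with h | h <;> simp [pow_succ, ← mul_assoc, h, mul_assoc _ (S.y 0), hyn]
    rcases hD k with h | h <;> rcases hy with h' | h' <;>
      simp [← mul_assoc, h, mul_assoc _ (S.y 0), h']

end Frame

section Cyclotomic

variable {R : Subring (Module.End ℤ A)} (hmul : ∀ f, LinearMap.mulLeft ℤ f ∈ R)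
  (hδ : ∀ i, i + 1 < a → S.δ i ∈ R)
  (hlin : ∀ T ∈ R, ∀ f, ∀ c ∈ S.sym a le_rfl, T (f * c) = T f * c)

include hδ in
theorem δProdRev_mem {n : ℕ} (hn : n < a) : S.δProdRev n ∈ R := by
  induction n with
  | zero => exact one_mem R
  | succ n ih => exact mul_mem (hδ n hn) (ih (by omega))

include hmul hδ hlin in
theorem nonempty_cyclotomic_equiv_matrix {N : ℕ} (haN : a ≤ N) (r : R → R → Prop)
    (r' : S.sym a le_rfl → S.sym a le_rfl → Prop)
    (hr : ∀ u v, r u v ↔ (1 ≤ a ∧ (u : Module.End ℤ A) = LinearMap.mulLeft ℤ (S.y 0) ^ N) ∧ v = 0)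
    (hr' : ∀ u v, r' u v ↔ (∃ m, N - a < m ∧ (u : A) = S.complete a m) ∧ v = 0) :
    Nonempty (RingQuot r ≃+* Matrix (Fin a.factorial) (Fin a.factorial) (RingQuot r')) := by
  obtain ⟨D, hD⟩ := S.exists_dualFamily hmul hδ (le_refl a)
  refine D.nonempty_ringQuot_equiv_matrix hlin hmul r r' ?_ ?_
  · intro u v huv i j
    obtain ⟨⟨ha, hu⟩, rfl⟩ := (hr u v).mp huv
    let I : Submodule A A :=
      { carrier := {f | ∀ g, RingQuot.mkRingHom r' ⟨D.l i (g * f), D.l_apply_mem _ _⟩ = 0}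
        add_mem' := fun {f f'} hf hf' g => by
          have := congrArg₂ (· + ·) (hf g) (hf' g)
          simp only [← map_add, add_zero] at this
          rw [← this]
          congr 2
          simp [mul_add]
        zero_mem' := fun g => by
          rw [← map_zero (RingQuot.mkRingHom r')]
          congr 2
          simp
        smul_mem' := fun c f hf g => by simpa [mul_assoc] using hf (g * c) }
    have hI : S.y 0 ^ N ∈ I := S.y_zero_pow_mem ha haN I fun m hm g => by
      have h1 : RingQuot.mkRingHom r' ⟨S.complete a m, S.complete_mem_sym le_rfl m⟩ = 0 := by
        rw [← map_zero (RingQuot.mkRingHom r')]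
        exact RingQuot.mkRingHom_rel ((hr' _ _).mpr ⟨⟨m, hm, rfl⟩, rfl⟩)
      have h2 : (⟨D.l i (g * S.complete a m), D.l_apply_mem _ _⟩ : S.sym a le_rfl) =
          ⟨D.l i g, D.l_apply_mem _ _⟩ * ⟨S.complete a m, S.complete_mem_sym le_rfl m⟩ :=
        Subtype.ext (D.l_mul _ _ _ (S.complete_mem_sym le_rfl m))
      rw [h2, map_mul, h1, mul_zero]
    have hcomm : S.y 0 ^ N * D.b j = D.b j * S.y 0 ^ N ∨
        S.y 0 ^ N * D.b j = -D.b j * S.y 0 ^ N := by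
      clear * - hD
      induction N with
      | zero => simp
      | succ N ih =>
        rcases ih with h | h <;> rcases hD j with h' | h' <;>
          simp [pow_succ, mul_assoc, h'] <;> simp [← mul_assoc, h]
    have hentry : ∃ g, (D.toMatrix hlin u i j : A) = D.l i (g * S.y 0 ^ N) := by
      rw [DualFamily.coe_toMatrix_apply, hu, LinearMap.pow_mulLeft, LinearMap.mulLeft_apply]
      rcases hcomm with h | h
      exacts [⟨_, by rw [h]⟩, ⟨_, by rw [h]⟩]
    obtain ⟨g, hg⟩ := hentry
    rw [map_zero, Matrix.zero_apply, map_zero, ← hI g]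
    exact congrArg _ (Subtype.ext hg)
  · intro u v huv i j
    obtain ⟨⟨m, hm, hu⟩, rfl⟩ := (hr' u v).mp huv
    rw [map_zero]
    rcases Nat.eq_zero_or_pos a with rfl | ha
    · obtain ⟨m, rfl⟩ : ∃ k, m = k + 1 := ⟨m - 1, by omega⟩
      rw [show u = 0 from Subtype.ext (by rw [hu, complete]; rfl), map_zero]
    have hy : RingQuot.mkRingHom r (⟨LinearMap.mulLeft ℤ (S.y 0), hmul _⟩ ^ N) = 0 := by
      rw [← map_zero (RingQuot.mkRingHom r)]
      exact RingQuot.mkRingHom_rel ((hr _ _).mpr ⟨⟨ha, rfl⟩, rfl⟩)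
    have hprod : D.ofEntry hmul i j u =
        ⟨LinearMap.mulLeft ℤ (D.b i), hmul _⟩ *
          ⟨S.δProdRev (a - 1), S.δProdRev_mem hδ (by omega)⟩ *
          ⟨LinearMap.mulLeft ℤ (S.y 0), hmul _⟩ ^ N *
          ⟨LinearMap.mulLeft ℤ (S.y 0), hmul _⟩ ^ (m + (a - 1) - N) * ⟨D.l j, D.l_mem j⟩ := by
      ext f
      have hc : S.complete a m = S.δProdRev (a - 1) (S.y 0 ^ (m + (a - 1))) := by
        rw [S.δProdRev_y_zero_pow (by omega), Nat.sub_add_cancel ha]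
      have hT := hlin _ (S.δProdRev_mem hδ (by omega : a - 1 < a)) (S.y 0 ^ (m + (a - 1))) _
        (D.l_apply_mem j f)
      rw [DualFamily.coe_ofEntry_apply, hu, hc, mul_assoc, ← hT]
      rw [mul_assoc _ (_ ^ N), ← pow_add, show N + (m + (a - 1) - N) = m + (a - 1) by omega]
      simp [LinearMap.pow_mulLeft]
    rw [hprod]
    simp only [map_mul, hy, mul_zero, zero_mul, map_zero]

end Cyclotomic

end OddDividedDifference

section SortedSymSum

variable {A : Type*} [Ring A]

/-- The sum of the products of `k` values of `f`, taken in increasing order of the indices. -/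
def sortedSymSum {n : ℕ} (f : Fin n → A) (k : ℕ) : A :=
  ∑ σ : Sym (Fin n) k, (((σ : Multiset (Fin n)).sort (· ≤ ·)).map f).prod

theorem sortedSymSum_zero_right {n : ℕ} (f : Fin n → A) : sortedSymSum f 0 = 1 := by
  simp [sortedSymSum, Sym.eq_nil_of_card_zero]

theorem sortedSymSum_zero_succ (f : Fin 0 → A) (k : ℕ) : sortedSymSum f (k + 1) = 0 := by
  simp [sortedSymSum]

theorem sortedSymSum_succ_succ {n : ℕ} (f : Fin (n + 1) → A) (k : ℕ) :
    sortedSymSum f (k + 1) =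
      sortedSymSum (fun i => f i.succ) (k + 1) + f 0 * sortedSymSum f k := by
  rw [sortedSymSum, ← ((Sym.equivCongr (finSuccEquiv n)).trans symOptionSuccEquiv).symm.sum_comp,
    Fintype.sum_sum_type, add_comm, sortedSymSum, sortedSymSum, Finset.mul_sum,
    ← (Sym.equivCongr (finSuccEquiv n)).sum_comp]
  congr 1
  · refine Finset.sum_congr rfl fun σ _ => ?_
    have h : (((((Sym.equivCongr (finSuccEquiv n)).trans symOptionSuccEquiv).symm (Sum.inr σ) :
        Sym (Fin (n + 1)) (k + 1)) : Multiset (Fin (n + 1)))) =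
        (σ : Multiset (Fin n)).map Fin.succ := by
      simp [symOptionSuccEquiv, Sym.equivCongr]
    rw [h, ← Multiset.map_sort (r := (· ≤ ·)) (hs := by simp)]
    simp [Function.comp_def]
  · refine Finset.sum_congr rfl fun σ _ => ?_
    have h : (((((Sym.equivCongr (finSuccEquiv n)).trans symOptionSuccEquiv).symm
        (Sum.inl (Sym.equivCongr (finSuccEquiv n) σ)) :
        Sym (Fin (n + 1)) (k + 1)) : Multiset (Fin (n + 1)))) =
        0 ::ₘ (σ : Multiset (Fin (n + 1))) := by
      simp [symOptionSuccEquiv, Sym.equivCongr, Sym.coe_cons]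
    rw [h, Multiset.sort_cons _ _ (· ≤ ·) (by simp)]
    simp

end SortedSymSum

namespace OddDividedDifference

variable {a : ℕ} {A : Type*} [Ring A] (S : OddDividedDifference a A)

section Reversal

variable (σ : A →+* A) (hσ : ∀ i < a, σ (S.y i) = S.y (a - 1 - i))

include hσ

theorem reversal_reversal (f : A) : σ (σ f) = f := by
  have h := S.eq_zero_of_stable
    ((σ.comp σ).toAddMonoidHom.toIntLinearMap - 1) (by simp) (fun j hj f hf => ?_) f
  · simpa [sub_eq_zero] using h
  · have hf' : σ (σ f) = f := by simpa [sub_eq_zero] using hf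
    simp [hσ j hj, hσ (a - 1 - j) (by omega), hf', show a - 1 - (a - 1 - j) = j by omega]

theorem reversal_δ {i : ℕ} (hi : i + 1 < a) (f : A) :
    σ (S.δ i f) = -S.δ (a - 2 - i) (σ f) := by
  have hi' : a - 2 - i + 1 < a := by omega
  have h := S.eq_zero_of_stable (σ.toAddMonoidHom.toIntLinearMap * S.δ i +
    S.δ (a - 2 - i) * σ.toAddMonoidHom.toIntLinearMap) ?_ (fun j hj f hf => ?_) f
  · exact eq_neg_of_add_eq_zero_left h
  · simp [S.δ_one hi, S.δ_one hi']
  · replace hf : σ (S.δ i f) = -S.δ (a - 2 - i) (σ f) := eq_neg_of_add_eq_zero_left hf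
    change σ (S.δ i (S.y j * f)) + S.δ (a - 2 - i) (σ (S.y j * f)) = 0
    rw [map_mul σ, hσ j hj]
    rcases eq_or_ne j i with rfl | h
    · rw [S.δ_left_mul hi, show a - 1 - j = a - 2 - j + 1 by omega, S.δ_right_mul hi', map_add,
        map_mul, hσ _ hi, hf, show a - 1 - (j + 1) = a - 2 - j by omega, mul_neg]
      abel
    rcases eq_or_ne j (i + 1) with rfl | h'
    · rw [S.δ_right_mul hi, show a - 1 - (i + 1) = a - 2 - i by omega, S.δ_left_mul hi', map_add,
        map_mul, map_neg, hσ i (by omega), hf, show a - 1 - i = a - 2 - i + 1 by omega, mul_neg]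
      abel
    · rw [S.δ_mul_of_ne hi hj h h', S.δ_mul_of_ne hi' (by omega) (by omega) (by omega), map_neg,
        map_mul, hf, hσ j hj, mul_neg, neg_neg, add_neg_cancel]

theorem reversal_mem_sym {f : A} (hf : f ∈ S.sym a le_rfl) : σ f ∈ S.sym a le_rfl := by
  intro i hi
  have h := S.reversal_δ σ hσ (i := a - 2 - i) (by omega) f
  rw [hf _ (by omega), map_zero, show a - 2 - (a - 2 - i) = i by omega] at h
  exact (neg_eq_zero.mp h.symm)

/-- The automorphism of the ring of odd symmetric polynomials that reverses the variables. -/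
def reversal : S.sym a le_rfl ≃+* S.sym a le_rfl :=
  RingEquiv.ofRingHom (σ.restrict _ _ fun _ => S.reversal_mem_sym σ hσ)
    (σ.restrict _ _ fun _ => S.reversal_mem_sym σ hσ)
    (by ext f; exact S.reversal_reversal σ hσ f) (by ext f; exact S.reversal_reversal σ hσ f)

theorem coe_reversal (f : S.sym a le_rfl) : (S.reversal σ hσ f : A) = σ f := rfl

theorem reversal_complete {n : ℕ} (hn : n ≤ a) (k : ℕ) :
    σ (S.complete n k) = sortedSymSum (fun i : Fin n => S.y (a - n + i)) k := by
  induction n generalizing k with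
  | zero => cases k <;> simp [complete, sortedSymSum_zero_right, sortedSymSum_zero_succ]
  | succ n ihn =>
    induction k with
    | zero => simp [sortedSymSum_zero_right]
    | succ k ihk =>
      rw [complete, map_add, map_mul, ihn (by omega), ihk, hσ n hn, sortedSymSum_succ_succ]
      congr 3
      · ext i
        congr 1
        simp
        omega
      · simp
        omega

end Reversal

/-- Odd divided difference operators in the usual normalisation, for variables and operators indexed
from `1`, rescaled to the signed variables `y i = (-1) ^ i • x (i + 1)`. -/
def ofUnsigned (x : ℕ → A)
    (hx : ∀ i j : ℕ, 1 ≤ i → i ≤ a → 1 ≤ j → j ≤ a → i ≠ j → x i * x j = -(x j * x i))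
    (hclosed : ∀ p : AddSubgroup A, 1 ∈ p →
      (∀ i : ℕ, 1 ≤ i → i ≤ a → ∀ f ∈ p, x i * f ∈ p) → ∀ f, f ∈ p)
    (s : ℕ → A →+* A)
    (hs : ∀ i j : ℕ, 1 ≤ i → i + 1 ≤ a → 1 ≤ j → j ≤ a →
      s i (x j) = if j = i then -x (i + 1) else if j = i + 1 then -x i else -x j)
    (d : ℕ → A →+ A)
    (hd1 : ∀ i : ℕ, 1 ≤ i → i + 1 ≤ a → d i 1 = 0)
    (hdx : ∀ i j : ℕ, 1 ≤ i → i + 1 ≤ a → 1 ≤ j → j ≤ a →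
      d i (x j) = if j = i ∨ j = i + 1 then 1 else 0)
    (hdL : ∀ i : ℕ, 1 ≤ i → i + 1 ≤ a → ∀ f g : A, d i (f * g) = d i f * g + s i f * d i g) :
    OddDividedDifference a A where
  y i := (-1 : ℤ) ^ i • x (i + 1)
  s i := s (i + 1)
  δ i := (-1 : ℤ) ^ i • (d (i + 1)).toIntLinearMap
  y_anticomm {i j} hi hj h := by
    rw [smul_mul_smul_comm, smul_mul_smul_comm,
      hx _ _ (by omega) (by omega) (by omega) (by omega) (by omega), smul_neg, mul_comm]
  s_left {i} hi := by
    rw [map_zsmul, hs _ _ (by omega) (by omega) (by omega) (by omega), if_pos rfl, pow_succ]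
    simp
  s_right {i} hi := by
    rw [map_zsmul, hs _ _ (by omega) (by omega) (by omega) (by omega), if_neg (by omega),
      if_pos rfl, pow_succ]
    simp
  s_of_ne {i j} hi hj h h' := by
    rw [map_zsmul, hs _ _ (by omega) (by omega) (by omega) (by omega), if_neg (by omega),
      if_neg (by omega), smul_neg]
  δ_one {i} hi := by simp [hd1 (i + 1) (by omega) (by omega)]
  δ_left {i} hi := by
    rw [LinearMap.smul_apply, AddMonoidHom.coe_toIntLinearMap, map_zsmul,
      hdx _ _ (by omega) (by omega) (by omega) (by omega), if_pos (.inl rfl), smul_smul,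
      ← mul_pow]
    simp
  δ_right {i} hi := by
    rw [LinearMap.smul_apply, AddMonoidHom.coe_toIntLinearMap, map_zsmul,
      hdx _ _ (by omega) (by omega) (by omega) (by omega), if_pos (.inr rfl), smul_smul,
      pow_succ, ← mul_assoc, ← mul_pow]
    simp
  δ_of_ne {i j} hi hj h h' := by
    rw [LinearMap.smul_apply, AddMonoidHom.coe_toIntLinearMap, map_zsmul,
      hdx _ _ (by omega) (by omega) (by omega) (by omega), if_neg (by omega), smul_zero, smul_zero]
  δ_mul {i} hi f g := by
    simp only [LinearMap.smul_apply, AddMonoidHom.coe_toIntLinearMap]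
    rw [hdL _ (by omega) (by omega), smul_add, smul_mul_assoc, mul_smul_comm]
  mem_of_closed p h1 hp f := by
    refine hclosed p h1 (fun i h0 hi f hf => ?_) f
    obtain ⟨i, rfl⟩ : ∃ j, i = j + 1 := ⟨i - 1, by omega⟩
    have h := zsmul_mem (hp i hi f hf) ((-1) ^ i)
    rw [smul_mul_assoc, smul_smul, ← mul_pow] at h
    simpa using h

variable {R : Subring (Module.End ℤ A)}

theorem mulLeft_mem (hR : ∀ i < a, LinearMap.mulLeft ℤ (S.y i) ∈ R) (f : A) :
    LinearMap.mulLeft ℤ f ∈ R := by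
  refine S.mem_of_closed (R.toAddSubgroup.comap (LinearMap.mul ℤ A).toAddMonoidHom) ?_ ?_ f
  · change LinearMap.mulLeft ℤ (1 : A) ∈ R
    rw [LinearMap.mulLeft_one]
    exact one_mem R
  · intro j hj f hf
    change LinearMap.mulLeft ℤ (S.y j * f) ∈ R
    rw [LinearMap.mulLeft_mul]
    exact mul_mem (hR j hj) hf

/-- The subring of endomorphisms that are right linear over a subring. -/
def _root_.Subring.rightLinear (P : Subring A) : Subring (Module.End ℤ A) where
  carrier := {T | ∀ f, ∀ c ∈ P, T (f * c) = T f * c}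
  mul_mem' hT hT' f c hc := by simp [hT' f c hc, hT _ c hc]
  one_mem' := by simp
  add_mem' hT hT' f c hc := by simp [hT f c hc, hT' f c hc, add_mul]
  zero_mem' := by simp
  neg_mem' hT f c hc := by simp [hT f c hc]

variable (x : ℕ → A) (hx : ∀ i, S.y i = (-1 : ℤ) ^ i • x (i + 1)) (d : ℕ → A →+ A)
  (hd : ∀ i, S.δ i = (-1 : ℤ) ^ i • (d (i + 1)).toIntLinearMap)

include hd in
theorem coe_sym_eq : (S.sym a le_rfl : Set A) = {f | ∀ i, 1 ≤ i → i + 1 ≤ a → d i f = 0} := by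
  have h (i : ℕ) (f : A) : S.δ i f = 0 ↔ d (i + 1) f = 0 := by
    rw [hd, LinearMap.smul_apply, AddMonoidHom.coe_toIntLinearMap]
    rcases neg_one_pow_eq_or ℤ i with h | h <;> simp [h]
  ext f
  refine ⟨fun hf i h1 hi => ?_, fun hf i hi => (h i f).mpr (hf (i + 1) (by omega) hi)⟩
  obtain ⟨i, rfl⟩ : ∃ j, i = j + 1 := ⟨i - 1, by omega⟩
  exact (h i f).mp (hf i hi)

include hx in
theorem exists_reversal
    (hlift : ∀ z : ℕ → A, (∀ i < a, ∀ j < a, i ≠ j → z i * z j = -(z j * z i)) →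
      ∃ φ : A →+* A, ∀ i < a, φ (x (i + 1)) = z i) :
    ∃ σ : A →+* A, ∀ i < a, σ (S.y i) = S.y (a - 1 - i) := by
  obtain ⟨σ, hσ⟩ := hlift (fun i => (-1 : ℤ) ^ i • S.y (a - 1 - i)) fun i hi j hj h => by
    rw [smul_mul_smul_comm, smul_mul_smul_comm, S.y_anticomm (by omega) (by omega) (by omega),
      smul_neg, mul_comm]
  refine ⟨σ, fun i hi => ?_⟩
  rw [hx i, map_zsmul, hσ i hi, smul_smul, ← mul_pow]
  simp

include hx hd in
/-- The cyclotomic quotient of the odd nilHecke ring is a matrix ring, with the odd Grassmannian ring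
presented by complete symmetric polynomials in increasing order of the variables. -/
theorem nonempty_cyclotomic_equiv_matrix_of_reversal {N : ℕ} (haN : a ≤ N)
    (G : Set (Module.End ℤ A))
    (hG : ∀ T, T ∈ G ↔ (∃ i < a, T = LinearMap.mulLeft ℤ (x (i + 1))) ∨
      ∃ i, 1 ≤ i ∧ i + 1 ≤ a ∧ T = (d i).toIntLinearMap)
    (σ : A →+* A) (hσ : ∀ i < a, σ (S.y i) = S.y (a - 1 - i))
    (h : ℕ → A) (hh : ∀ m, h m = sortedSymSum (fun i : Fin a => S.y i) m) :
    Nonempty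
      (RingQuot (fun u v : ↥(Subring.closure G) =>
          (1 ≤ a ∧ (u : Module.End ℤ A) = LinearMap.mulLeft ℤ (x 1) ^ N) ∧ v = 0) ≃+*
        Matrix (Fin a.factorial) (Fin a.factorial)
          (RingQuot (fun u v : ↥(S.sym a le_rfl) =>
            (∃ m : ℕ, N - a < m ∧ (u : A) = h m) ∧ v = 0))) := by
  have hR : Subring.closure G ≤ (S.sym a le_rfl).rightLinear := by
    refine (Subring.closure_le).mpr fun T hT => ?_
    rcases (hG T).mp hT with ⟨i, -, rfl⟩ | ⟨i, h1, hi, rfl⟩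
    · exact fun g c _ => (mul_assoc _ g c).symm
    · intro g c hc
      obtain ⟨i, rfl⟩ : ∃ j, i = j + 1 := ⟨i - 1, by omega⟩
      have h := S.δ_mul_sym le_rfl hi g hc
      rw [hd, LinearMap.smul_apply, LinearMap.smul_apply, smul_mul_assoc] at h
      rcases neg_one_pow_eq_or ℤ i with h' | h' <;> simpa [h'] using h
  obtain ⟨e⟩ := S.nonempty_cyclotomic_equiv_matrix (R := Subring.closure G)
    (S.mulLeft_mem fun i hi => by
      have h : LinearMap.mulLeft ℤ (S.y i) = (-1 : ℤ) ^ i • LinearMap.mulLeft ℤ (x (i + 1)) := by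
        rw [hx i]
        ext f
        exact smul_mul_assoc _ _ _
      exact h ▸ zsmul_mem (Subring.subset_closure ((hG _).mpr (.inl ⟨i, hi, rfl⟩))) _)
    (fun i hi => hd i ▸
      zsmul_mem (Subring.subset_closure ((hG _).mpr (.inr ⟨i + 1, by omega, hi, rfl⟩))) _)
    (fun T hT => hR hT) haN
    (fun u v => (1 ≤ a ∧ (u : Module.End ℤ A) = LinearMap.mulLeft ℤ (x 1) ^ N) ∧ v = 0)
    (fun u v => (∃ m, N - a < m ∧ (u : A) = S.complete a m) ∧ v = 0)
    (fun _ _ => by simp [hx 0]) (fun _ _ => Iff.rfl)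
  refine ⟨e.trans (RingEquiv.mapMatrix (RingQuot.congr (S.reversal σ hσ) fun u v => ?_))⟩
  have hu (m : ℕ) : (u : A) = S.complete a m ↔ (S.reversal σ hσ u : A) = h m := by
    have hc := S.reversal_complete σ hσ le_rfl m
    simp only [Nat.sub_self, zero_add] at hc
    rw [coe_reversal, hh, ← hc,
      (Function.LeftInverse.injective (S.reversal_reversal σ hσ)).eq_iff]
  simp [hu]

end OddDividedDifference

section OddPolynomials

variable {a : ℕ}

theorem OX_anticomm {i j : Fin a} (h : i ≠ j) : (OX i * OX j : OPol a) = -(OX j * OX i) := by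
  have := RingQuot.mkRingHom_rel (OddRel.anticomm i j h)
  rwa [map_mul, map_neg, map_mul] at this

theorem xv_succ {i : ℕ} (hi : i < a) : xv a (i + 1) = OX ⟨i, hi⟩ := by
  simp [xv, hi]

theorem xv_anticomm (i j : ℕ) (hi : 1 ≤ i) (hia : i ≤ a) (hj : 1 ≤ j) (hja : j ≤ a) (h : i ≠ j) :
    xv a i * xv a j = -(xv a j * xv a i) := by
  obtain ⟨i, rfl⟩ : ∃ k, i = k + 1 := ⟨i - 1, by omega⟩
  obtain ⟨j, rfl⟩ : ∃ k, j = k + 1 := ⟨j - 1, by omega⟩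
  rw [xv_succ hia, xv_succ hja, OX_anticomm (by simpa using h)]

theorem OPol_mem_of_closed (p : AddSubgroup (OPol a)) (h1 : 1 ∈ p)
    (hp : ∀ i : ℕ, 1 ≤ i → i ≤ a → ∀ f ∈ p, xv a i * f ∈ p) (f : OPol a) : f ∈ p := by
  suffices h : ∀ (t : FreeAlgebra ℤ (Fin a)), ∀ f ∈ p, RingQuot.mkRingHom (OddRel a) t * f ∈ p by
    obtain ⟨t, rfl⟩ := RingQuot.mkRingHom_surjective (OddRel a) f
    simpa using h t 1 h1
  intro t
  induction t using FreeAlgebra.induction with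
  | grade0 r =>
    intro f hf
    rw [eq_intCast (algebraMap ℤ (FreeAlgebra ℤ (Fin a))) r, map_intCast, ← zsmul_eq_mul]
    exact zsmul_mem hf r
  | grade1 i =>
    have h := hp (i + 1) (by omega) i.2
    rwa [xv_succ i.2] at h
  | mul t t' ht ht' =>
    intro f hf
    rw [map_mul, mul_assoc]
    exact ht _ (ht' f hf)
  | add t t' ht ht' =>
    intro f hf
    rw [map_add, add_mul]
    exact add_mem (ht f hf) (ht' f hf)

theorem exists_oddPolynomial_hom {B : Type*} [Ring B] (z : ℕ → B)
    (hz : ∀ i < a, ∀ j < a, i ≠ j → z i * z j = -(z j * z i)) :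
    ∃ φ : OPol a →+* B, ∀ i < a, φ (xv a (i + 1)) = z i := by
  refine ⟨RingQuot.lift ⟨(FreeAlgebra.lift ℤ fun i : Fin a => z i).toRingHom, ?_⟩, fun i hi => ?_⟩
  · rintro _ _ ⟨i, j, h⟩
    simpa using hz i i.2 j j.2 (by simpa [Fin.ext_iff] using h)
  · rw [xv_succ hi, OX, RingQuot.lift_mkRingHom_apply]
    simp

end OddPolynomials

set_option synthInstance.maxHeartbeats 1000000 in
set_option maxHeartbeats 1000000 in
/-- the cyclotomic quotient ONH_a^N = ONH_a/⟨x_1^N⟩ is isomorphic to the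
a!×a! matrix ring over the odd Grassmannian ring OH_{a,N} = OΛ_a/⟨h_m : m > N−a⟩. -/
theorem cyclotomic_odd_nilHecke_matrix (a N : ℕ) (haN : a ≤ N)
    (s : ℕ → OPol a →+* OPol a)
    (hs : ∀ i j : ℕ, 1 ≤ i → i + 1 ≤ a → 1 ≤ j → j ≤ a →
      s i (xv a j) =
        if j = i then -xv a (i + 1) else if j = i + 1 then -xv a i else -xv a j)
    (d : ℕ → OPol a →+ OPol a)
    (hd1 : ∀ i : ℕ, 1 ≤ i → i + 1 ≤ a → d i 1 = 0)
    (hdx : ∀ i j : ℕ, 1 ≤ i → i + 1 ≤ a → 1 ≤ j → j ≤ a →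
      d i (xv a j) = if j = i ∨ j = i + 1 then 1 else 0)
    (hdL : ∀ i : ℕ, 1 ≤ i → i + 1 ≤ a → ∀ f g : OPol a,
      d i (f * g) = d i f * g + s i f * d i g) :
    ∃ OL : Subring (OPol a),
      (OL : Set (OPol a)) = {f : OPol a | ∀ i : ℕ, 1 ≤ i → i + 1 ≤ a → d i f = 0} ∧
      Nonempty
        (RingQuot (fun u v : ↥(Subring.closure (onhGens a d)) =>
            (1 ≤ a ∧ (u : Module.End ℤ (OPol a)) = mulL (xv a 1) ^ N) ∧ v = 0) ≃+*
          Matrix (Fin (Nat.factorial a)) (Fin (Nat.factorial a))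
            (RingQuot (fun u v : ↥OL =>
              (∃ m : ℕ, N - a < m ∧ (u : OPol a) = hp a m) ∧ v = 0))) := by
  let S : OddDividedDifference a (OPol a) := .ofUnsigned (xv a) xv_anticomm OPol_mem_of_closed
    s hs d hd1 hdx hdL
  obtain ⟨σ, hσ⟩ := S.exists_reversal (xv a) (fun _ => rfl) exists_oddPolynomial_hom
  have hy : xt a = fun i : Fin a => S.y i := by
    ext i
    change _ = (-1 : ℤ) ^ (i : ℕ) • xv a (i + 1)
    rw [xv_succ i.2, xt, zsmul_eq_mul]
    simp
  refine ⟨S.sym a le_rfl, S.coe_sym_eq d fun _ => rfl,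
    S.nonempty_cyclotomic_equiv_matrix_of_reversal (xv a) (fun _ => rfl) d (fun _ => rfl)
      haN (onhGens a d) (fun T => or_congr_left ?_) σ hσ (hp a) fun m => by rw [hp, hy]; rfl⟩
  refine ⟨fun ⟨i, hi⟩ => ⟨i, i.2, ?_⟩, fun ⟨i, hi, hT⟩ => ⟨⟨i, hi⟩, ?_⟩⟩
  · rw [hi, xv_succ i.2]
    rfl
  · rw [hT, xv_succ hi]
    rfl
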